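/- arXiv:2104.11442 — 2 statements merged into one kernel-verified Lean document; each statement's English description precedes it below -/
import Mathlib

section
/- Fix strictly increasing α, β : ℚ → ℚ with α x < β x < α (x + ε) for all x and all ε > 0, and let mx be the induced operation. Let m, n : ℕ and let S ⊆ ((Fin m → ℚ) × ℚ × (Fin n → ℚ)) be such that (i) for all (z, y, x), (z', y', x') ∈ S, the componentwise application ((fun i => mx (z i) (z' i)), mx y y', (fun i => mx (x i) (x' i))) lies in S, and (ii) for every order isomorphism σ : ℚ ≃o ℚ and every (z, y, x) ∈ S, (σ ∘ z, σ y, σ ∘ x) ∈ S. If there exists z₀ : Fin m → ℚ such that for every y : ℚ there exists x with (z₀, y, x) ∈ S, then for every z : Fin m → ℚ: (∀ y, ∃ x, (z, y, x) ∈ S) if and only if (∃ y, ∃ x, (z, y, x) ∈ S ∧ ∀ i, z i < y). (Lemma on eliminating a universal quantifier, mx case.) -/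
/-- The operation `mx` induced by unary operations `α`, `β`. -/
def mxOp (α β : ℚ → ℚ) : ℚ → ℚ → ℚ :=
  fun x y => if x = y then β x else α (min x y)

/-- For `c < a` and `c < b` some automorphism of `ℚ` fixes `(-∞, c]` pointwise and maps `a`
to `b`. -/
theorem exists_orderIso_fix_Iic_map {c a b : ℚ} (ha : c < a) (hb : c < b) :
    ∃ τ : ℚ ≃o ℚ, (∀ x ≤ c, τ x = x) ∧ τ a = b := by
  have ha' : 0 < a - c := sub_pos.2 ha
  have hb' : 0 < b - c := sub_pos.2 hb
  set k : ℚ := (b - c) / (a - c) with hk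
  have hk0 : 0 < k := div_pos hb' ha'
  set f : ℚ → ℚ := fun x => if x ≤ c then x else c + k * (x - c) with hf
  have hmono : StrictMono f := by
    intro x y hxy
    simp only [hf]
    split_ifs with hx hy hy
    · exact hxy
    · have := mul_pos hk0 (sub_pos.2 (not_le.1 hy))
      linarith
    · linarith
    · have := mul_lt_mul_of_pos_left (sub_lt_sub_right hxy c) hk0
      linarith
  have hsurj : Function.Surjective f := by
    intro y
    by_cases hy : y ≤ c
    · exact ⟨y, if_pos hy⟩
    · have hpos : 0 < (y - c) / k := div_pos (sub_pos.2 (not_le.1 hy)) hk0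
      refine ⟨c + (y - c) / k, ?_⟩
      simp only [hf]
      rw [if_neg (by linarith), add_sub_cancel_left, mul_div_cancel₀ _ hk0.ne']
      ring
  refine ⟨hmono.orderIsoOfSurjective f hsurj, fun x hx => ?_, ?_⟩
  · exact if_pos hx
  · change f a = b
    simp only [hf]
    rw [if_neg (not_le.2 ha), hk, div_mul_cancel₀ _ ha'.ne']
    ring

/-- Strictly increasing functions on `ℚ` agree with automorphisms of `ℚ` on finite sets. -/
theorem StrictMono.exists_orderIso_eqOn_finset {f : ℚ → ℚ} (hf : StrictMono f) (s : Finset ℚ) :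
    ∃ σ : ℚ ≃o ℚ, ∀ x ∈ s, σ x = f x := by
  induction s using Finset.induction_on_max with
  | empty => exact ⟨OrderIso.refl ℚ, by simp⟩
  | insert a s hlt ih =>
    obtain ⟨σ, hσ⟩ := ih
    obtain ⟨c, hc, hc'⟩ := Order.exists_between_finsets (s.image f) {σ a, f a} (by
      simp only [Finset.mem_image, Finset.mem_insert, Finset.mem_singleton]
      rintro _ ⟨x, hx, rfl⟩ y (rfl | rfl)
      · rw [← hσ x hx]
        exact σ.strictMono (hlt x hx)
      · exact hf (hlt x hx))
    obtain ⟨τ, hτ, hτa⟩ := exists_orderIso_fix_Iic_map (hc' (σ a) (by simp)) (hc' (f a) (by simp))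
    refine ⟨σ.trans τ, fun x hx => ?_⟩
    rcases Finset.mem_insert.1 hx with rfl | hx
    · exact hτa
    · rw [OrderIso.trans_apply, hσ x hx]
      exact hτ _ (hc _ (Finset.mem_image_of_mem f hx)).le

theorem mxOp_of_lt {α β : ℚ → ℚ} {x y : ℚ} (h : x < y) : mxOp α β x y = α x := by
  rw [mxOp, if_neg h.ne, min_eq_left h.le]

theorem mxOp_of_gt {α β : ℚ → ℚ} {x y : ℚ} (h : y < x) : mxOp α β x y = α y := by
  rw [mxOp, if_neg h.ne', min_eq_right h.le]

theorem eliminate_universal_mx {m n : ℕ} (α β : ℚ → ℚ)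
    (hα : StrictMono α) (hβ : StrictMono β)
    (hαβ : ∀ x ε : ℚ, 0 < ε → α x < β x ∧ β x < α (x + ε))
    (S : Set ((Fin m → ℚ) × ℚ × (Fin n → ℚ)))
    (hmx : ∀ p ∈ S, ∀ q ∈ S,
      ((fun i => mxOp α β (p.1 i) (q.1 i)), mxOp α β p.2.1 q.2.1,
        (fun i => mxOp α β (p.2.2 i) (q.2.2 i))) ∈ S)
    (hauto : ∀ σ : ℚ ≃o ℚ, ∀ p ∈ S, (σ ∘ p.1, σ p.2.1, σ ∘ p.2.2) ∈ S)
    (hsat : ∃ z₀ : Fin m → ℚ, ∀ y : ℚ, ∃ x : Fin n → ℚ, (z₀, y, x) ∈ S) :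
    ∀ z : Fin m → ℚ,
      (∀ y : ℚ, ∃ x : Fin n → ℚ, (z, y, x) ∈ S) ↔
      (∃ y : ℚ, ∃ x : Fin n → ℚ, (z, y, x) ∈ S ∧ ∀ i, z i < y) := by
  intro z
  constructor
  · intro h
    obtain ⟨M, hM⟩ := (Set.finite_range z).bddAbove
    obtain ⟨x, hx⟩ := h (M + 1)
    exact ⟨M + 1, x, hx, fun i => (hM ⟨i, rfl⟩).trans_lt (lt_add_one M)⟩
  · rintro ⟨y, x, hS, hzy⟩ w
    -- Move `y` above `w` while fixing `z`.
    obtain ⟨c, hc, hcy⟩ := Order.exists_between_finsets (Finset.univ.image z) {y} (by simpa)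
    have hcy : c < y := hcy y (by simp)
    have hzc : ∀ i, z i < c := fun i => hc _ (by simp)
    obtain ⟨τ, hτ, hτy⟩ := exists_orderIso_fix_Iic_map hcy
      (show c < max c w + 1 from (le_max_left c w).trans_lt (lt_add_one _))
    have hS' := hauto τ _ hS
    -- Move the satisfying tuple `z₀` above `z`.
    obtain ⟨z₀, hz₀⟩ := hsat
    obtain ⟨M, hM⟩ := (Set.finite_range fun i => z i - z₀ i).bddAbove
    obtain ⟨x', hx'⟩ := hz₀ (w - (M + 1))
    have hS₀ := hauto (OrderIso.addRight (M + 1)) _ hx'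
    have hmin := hmx _ hS' _ hS₀
    obtain ⟨σ, hσ⟩ := hα.exists_orderIso_eqOn_finset (insert w (Finset.univ.image z))
    have hz : (σ.symm ∘ fun i => mxOp α β (τ (z i)) (z₀ i + (M + 1))) = z := by
      funext i
      have hi : z i < z₀ i + (M + 1) := by
        have : z i - z₀ i ≤ M := hM ⟨i, rfl⟩
        linarith
      simp only [Function.comp_apply, hτ _ (hzc i).le, mxOp_of_lt hi]
      rw [← hσ (z i) (by simp), σ.symm_apply_apply]
    have hw : σ.symm (mxOp α β (τ y) (w - (M + 1) + (M + 1))) = w := by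
      have hlt : w < max c w + 1 := (le_max_right c w).trans_lt (lt_add_one _)
      rw [hτy, sub_add_cancel, mxOp_of_gt hlt, ← hσ w (by simp), σ.symm_apply_apply]
    have hfin : (σ.symm ∘ fun i => mxOp α β (τ (z i)) (z₀ i + (M + 1)),
        σ.symm (mxOp α β (τ y) (w - (M + 1) + (M + 1))),
        σ.symm ∘ fun i => mxOp α β (τ (x i)) (x' i + (M + 1))) ∈ S := hauto σ.symm _ hmin
    rw [hz, hw] at hfin
    exact ⟨_, hfin⟩
end

section
/- Fix strictly increasing α, β : ℚ → ℚ with α x < β x < α (x + ε) for all x and all ε > 0, and let mx be the induced operation. Let n ≥ 1 and b, b' : Fin n → ℚ have equal minimum values (i.e., there are i ∈ min-set of b and i' ∈ min-set of b' with b i = b' i'). Let c = (fun i => mx (b i) (b' i)). If the min-sets of b and b' coincide, then the min-set of c equals the min-set of b; if they differ, then the min-set of c equals the symmetric difference of the min-set of b and the min-set of b'. -/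
/-- The set of coordinates at which a tuple attains its minimum value. -/
def minSet {n : ℕ} (b : Fin n → ℚ) : Set (Fin n) := {i | ∀ j, b i ≤ b j}

theorem mem_minSet_iff_eq {n : ℕ} {c : Fin n → ℚ} {v : ℚ} (hle : ∀ j, v ≤ c j)
    (hv : ∃ j, c j = v) (i : Fin n) : i ∈ minSet c ↔ c i = v := by
  obtain ⟨k, hk⟩ := hv
  exact ⟨fun h => le_antisymm (hk ▸ h k) (hle i), fun h j => h ▸ hle j⟩

theorem lt_mxOp {α β : ℚ → ℚ}
    (hαβ : ∀ x ε : ℚ, 0 < ε → α x < β x ∧ β x < α (x + ε))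
    {m x y : ℚ} (hx : m < x) (hy : m < y) : β m < mxOp α β x y := by
  have h_min : β m < α (min x y) := by
    simpa using (hαβ m (min x y - m) (sub_pos.2 (lt_min hx hy))).2
  unfold mxOp
  split_ifs with h
  · subst h
    exact (min_self x ▸ h_min).trans (hαβ x 1 one_pos).1
  · exact h_min

theorem mxOp_left {α β : ℚ → ℚ} {m y : ℚ} (hy : m < y) : mxOp α β m y = α m := by
  simp [mxOp, hy.ne, hy.le]

theorem mxOp_right {α β : ℚ → ℚ} {m x : ℚ} (hx : m < x) : mxOp α β x m = α m := by
  simp [mxOp, hx.ne', hx.le]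

theorem mxOp_self {α β : ℚ → ℚ} (m : ℚ) : mxOp α β m m = β m := by
  simp [mxOp]

theorem mx_minSet_equal_minima {n : ℕ} (α β : ℚ → ℚ)
    (hα : StrictMono α) (hβ : StrictMono β)
    (hαβ : ∀ x ε : ℚ, 0 < ε → α x < β x ∧ β x < α (x + ε))
    (hn : 1 ≤ n) (b b' : Fin n → ℚ)
    (heq : ∃ i ∈ minSet b, ∃ i' ∈ minSet b', b i = b' i') :
    (minSet b = minSet b' →
      minSet (fun i => mxOp α β (b i) (b' i)) = minSet b) ∧
    (minSet b ≠ minSet b' →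
      minSet (fun i => mxOp α β (b i) (b' i)) = symmDiff (minSet b) (minSet b')) := by
  obtain ⟨k, hk, k', hk', hkk⟩ := heq
  obtain ⟨m, hm⟩ : ∃ m, b k = m := ⟨_, rfl⟩
  have hm' : b' k' = m := hkk ▸ hm
  have hb : ∀ j, m ≤ b j := fun j => hm ▸ hk j
  have hb' : ∀ j, m ≤ b' j := fun j => hm' ▸ hk' j
  have mem_b := mem_minSet_iff_eq hb ⟨k, hm⟩
  have mem_b' := mem_minSet_iff_eq hb' ⟨k', hm'⟩
  have hαm : α m < β m := (hαβ m 1 one_pos).1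
  have value (i : Fin n) :
      (b i = m ∧ b' i = m ∧ mxOp α β (b i) (b' i) = β m) ∨
      (b i = m ∧ b' i ≠ m ∧ mxOp α β (b i) (b' i) = α m) ∨
      (b i ≠ m ∧ b' i = m ∧ mxOp α β (b i) (b' i) = α m) ∨
      (b i ≠ m ∧ b' i ≠ m ∧ β m < mxOp α β (b i) (b' i)) := by
    rcases (hb i).eq_or_lt with h | h <;> rcases (hb' i).eq_or_lt with h' | h'
    · exact .inl ⟨h.symm, h'.symm, by rw [← h, ← h', mxOp_self]⟩
    · exact .inr (.inl ⟨h.symm, h'.ne', by rw [← h, mxOp_left h']⟩)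
    · exact .inr (.inr (.inl ⟨h.ne', h'.symm, by rw [← h', mxOp_right h]⟩))
    · exact .inr (.inr (.inr ⟨h.ne', h'.ne', lt_mxOp hαβ h h'⟩))
  constructor
  · intro h
    have hiff (i : Fin n) : b i = m ↔ b' i = m := by rw [← mem_b, ← mem_b', h]
    ext i
    rw [mem_b, mem_minSet_iff_eq (v := β m)]
    · grind
    · grind
    · exact ⟨k, by grind⟩
  · intro h
    obtain ⟨l, hl⟩ : ∃ l, ¬(b l = m ↔ b' l = m) := by
      by_contra! hiff
      exact h (Set.ext fun i => by rw [mem_b, mem_b', hiff])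
    ext i
    rw [Set.mem_symmDiff, mem_b, mem_b', mem_minSet_iff_eq (v := α m)]
    · grind
    · grind
    · exact ⟨l, by grind⟩
end
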